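/- Let L > a ≥ 0 and b ≥ 0 be integers. For each composition A = (A₁,…,A_{L−a+1}) ∈ C_L(L−a+1) and each B = (B₁,…,B_{L−a+1}) ∈ G_b(L−a+1), let 𝔰 = 𝔰(A,B) be the minimal index with A_𝔰 + 2B_𝔰 = max_{1 ≤ i ≤ L−a+1} (A_i + 2B_i), and let 𝔥 = 𝔥(A,B) be the minimal index in {1,…,L−a+1} \ {𝔰} with A_𝔥 + 2B_𝔥 = max_{i ≠ 𝔰} (A_i + 2B_i). Then Σ_{A ∈ C_L(L−a+1)} Σ_{B ∈ G_b(L−a+1)} (A_𝔥 + 2B_𝔥 + 1) · ∏_{i=1}^{L−a+1} (A_i + 2B_i)! / (A_i! · B_i!) ≤ 2^{9L+5} · (a + 2b)! / (a! · b!). -/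

import Mathlib

open Nat Finset

/-- `compositions n k` is the set `C_n(k)` of compositions of `n` of length `k`:
ordered `k`-tuples of positive integers summing to `n`. -/
def compositions (n k : ℕ) : Finset (Fin k → ℕ) :=
  (Finset.Nat.antidiagonalTuple k n).filter fun f => ∀ i, 0 < f i

/-- `weakCompositions n k` is the set `G_n(k)` of ordered `k`-tuples of nonnegative
integers summing to `n`. -/
def weakCompositions (n k : ℕ) : Finset (Fin k → ℕ) :=
  Finset.Nat.antidiagonalTuple k n

/-- The minimal index `i ∈ S` at which `g` attains its maximum over `S`
(an arbitrary default value `0` if `S = ∅`). -/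
noncomputable def minIdxOfMaxOn {k : ℕ} [NeZero k] (g : Fin k → ℕ) (S : Finset (Fin k)) :
    Fin k :=
  if h : (S.filter fun i => ∀ j ∈ S, g j ≤ g i).Nonempty then
    (S.filter fun i => ∀ j ∈ S, g j ≤ g i).min' h
  else 0

/-- `𝔰(A,B)`: the minimal index `𝔰` with `A_𝔰 + 2B_𝔰 = max_i (A_i + 2B_i)`. -/
noncomputable def sIdx {k : ℕ} [NeZero k] (A B : Fin k → ℕ) : Fin k :=
  minIdxOfMaxOn (fun i => A i + 2 * B i) Finset.univ

/-- `𝔥(A,B)`: the minimal index `𝔥 ≠ 𝔰(A,B)` with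
`A_𝔥 + 2B_𝔥 = max_{i ≠ 𝔰} (A_i + 2B_i)`. -/
noncomputable def hIdx {k : ℕ} [NeZero k] (A B : Fin k → ℕ) : Fin k :=
  minIdxOfMaxOn (fun i => A i + 2 * B i) (Finset.univ.erase (sIdx A B))

theorem sum_antidiagonalTuple_succ {R : Type*} [AddCommMonoid R] (k n : ℕ)
    (F : (Fin (k + 1) → ℕ) → R) :
    ∑ f ∈ Finset.Nat.antidiagonalTuple (k + 1) n, F f =
      ∑ p ∈ antidiagonal n, ∑ f ∈ Finset.Nat.antidiagonalTuple k p.2, F (Fin.cons p.1 f) := by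
  rw [Finset.sum_sigma']
  refine Finset.sum_bij' (fun f _ => ⟨(f 0, ∑ i, Fin.tail f i), Fin.tail f⟩)
    (fun q _ => Fin.cons q.1.1 q.2) ?_ ?_ ?_ ?_ ?_
  · intro f hf
    rw [Finset.Nat.mem_antidiagonalTuple, Fin.sum_univ_succ] at hf
    simp [Finset.Nat.mem_antidiagonalTuple, Fin.tail, hf]
  · rintro ⟨⟨c, d⟩, f⟩ hq
    simp only [mem_sigma, Finset.HasAntidiagonal.mem_antidiagonal,
      Finset.Nat.mem_antidiagonalTuple] at hq
    simp [Finset.Nat.mem_antidiagonalTuple, Fin.sum_univ_succ, hq]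
  · intro f _
    simp
  · rintro ⟨⟨c, d⟩, f⟩ hq
    simp only [mem_sigma, Finset.HasAntidiagonal.mem_antidiagonal,
      Finset.Nat.mem_antidiagonalTuple] at hq
    simp [hq]
  · intro f _
    simp

theorem card_compositions_le (n k : ℕ) : #(compositions n k) ≤ 2 ^ n := by
  induction k generalizing n with
  | zero =>
    calc #(compositions n 0) ≤ Fintype.card (Fin 0 → ℕ) := Finset.card_le_univ _
      _ = 1 := by simp
      _ ≤ 2 ^ n := Nat.one_le_two_pow
  | succ k ih =>
    have hrec : #(compositions n (k + 1)) =
        ∑ p ∈ antidiagonal n, if 0 < p.1 then #(compositions p.2 k) else 0 := by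
      unfold compositions
      rw [Finset.card_filter, sum_antidiagonalTuple_succ]
      refine Finset.sum_congr rfl fun p _ => ?_
      split_ifs with hp
      · rw [Finset.card_filter]
        simp only [Fin.forall_fin_succ, Fin.cons_zero, Fin.cons_succ, hp, true_and]
      · simp [Fin.forall_fin_succ, hp]
    rw [hrec, Finset.Nat.sum_antidiagonal_eq_sum_range_succ_mk, Finset.sum_range_succ']
    simp only [lt_irrefl, if_false, add_zero]
    calc ∑ i ∈ range n, (if 0 < i + 1 then #(compositions (n - (i + 1)) k) else 0)
        ≤ ∑ i ∈ range n, 2 ^ (n - 1 - i) := by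
          refine Finset.sum_le_sum fun i _ => ?_
          rw [if_pos i.succ_pos, show n - 1 - i = n - (i + 1) by omega]
          exact ih _
      _ = ∑ i ∈ range n, 2 ^ i := Finset.sum_range_reflect (fun i => 2 ^ i) n
      _ ≤ 2 ^ n := (Nat.geomSum_lt le_rfl fun i hi => Finset.mem_range.mp hi).le

theorem minIdxOfMaxOn_spec {k : ℕ} [NeZero k] (g : Fin k → ℕ) {S : Finset (Fin k)}
    (hS : S.Nonempty) :
    minIdxOfMaxOn g S ∈ S ∧ ∀ j ∈ S, g j ≤ g (minIdxOfMaxOn g S) := by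
  have hne : (S.filter fun i => ∀ j ∈ S, g j ≤ g i).Nonempty := by
    obtain ⟨i, hi, hmax⟩ := S.exists_max_image g hS
    exact ⟨i, Finset.mem_filter.mpr ⟨hi, hmax⟩⟩
  rw [minIdxOfMaxOn, dif_pos hne]
  exact Finset.mem_filter.mp (Finset.min'_mem _ hne)

theorem choose_mul_choose_le_choose_add (m n i j : ℕ) :
    m.choose i * n.choose j ≤ (m + n).choose (i + j) := by
  rw [Nat.add_choose_eq]
  exact Finset.single_le_sum (f := fun p : ℕ × ℕ => m.choose p.1 * n.choose p.2)
    (fun _ _ => Nat.zero_le _)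
    (Finset.HasAntidiagonal.mem_antidiagonal.mpr (rfl : (i, j).1 + (i, j).2 = i + j))

theorem two_pow_le_choose {e d : ℕ} (h : e ≤ d) : 2 ^ e ≤ (e + d).choose e := by
  induction e with
  | zero => simp
  | succ e ih =>
    have ih := ih (by omega)
    have hmul := Nat.add_one_mul_choose_eq (e + d) e
    rw [show e + 1 + d = e + d + 1 by ring]
    refine Nat.le_of_mul_le_mul_right ?_ e.succ_pos
    rw [Nat.succ_eq_add_one, ← hmul, pow_succ]
    nlinarith

/-- The weight `(A + 2B)! / (A! B!)` of a single part. -/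
noncomputable def partWeight (A B : ℕ) : ℝ := ((A + 2 * B)! : ℝ) / ((A)! * (B)!)

theorem partWeight_pos (A B : ℕ) : 0 < partWeight A B := by
  unfold partWeight
  positivity

@[simp]
theorem partWeight_zero_right (A : ℕ) : partWeight A 0 = 1 := by
  have : ((A)! : ℝ) ≠ 0 := by positivity
  simp [partWeight, this]

theorem partWeight_le_succ (A B : ℕ) : partWeight A B ≤ partWeight (A + 1) B := by
  unfold partWeight
  rw [div_le_div_iff₀ (by positivity) (by positivity), show A + 1 + 2 * B = A + 2 * B + 1 by ring,
    Nat.factorial_succ, Nat.factorial_succ]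
  push_cast
  have hle : (A + 1 : ℝ) ≤ A + 2 * B + 1 := by
    have : (0 : ℝ) ≤ B := by positivity
    linarith
  have := mul_le_mul_of_nonneg_right hle
    (by positivity : (0 : ℝ) ≤ (A + 2 * B)! * ((A)! * (B)!))
  linarith

theorem partWeight_monotone (B : ℕ) : Monotone fun A => partWeight A B :=
  monotone_nat_of_le_succ fun A => partWeight_le_succ A B

theorem partWeight_mul_choose_le (x y c d : ℕ) :
    partWeight (x + 1) c * partWeight (y + 1) d * (c + d).choose c ≤
      (1 + c + d) * partWeight (x + y + 1) (c + d) := by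
  have hvand : (x + 1 + (y + 1)).choose (x + 1) * ((c + d).choose c * (c + d).choose c) ≤
      (x + 1 + 2 * c + (y + 1 + 2 * d)).choose (x + 1 + 2 * c) := by
    refine (Nat.mul_le_mul_left _ (choose_mul_choose_le_choose_add _ _ _ _)).trans ?_
    rw [show x + 1 + 2 * c + (y + 1 + 2 * d) = x + 1 + (y + 1) + (c + d + (c + d)) by ring,
      two_mul]
    exact choose_mul_choose_le_choose_add _ _ _ _
  have hvand' : ((x + 1 + (y + 1)).choose (x + 1) * ((c + d).choose c * (c + d).choose c) : ℝ) ≤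
      (x + 1 + 2 * c + (y + 1 + 2 * d)).choose (x + 1 + 2 * c) := by exact_mod_cast hvand
  rw [Nat.cast_add_choose, Nat.cast_add_choose, Nat.cast_add_choose] at hvand'
  have hn : x + 1 + 2 * c + (y + 1 + 2 * d) = x + y + 1 + 2 * (c + d) + 1 := by ring
  have hx : x + 1 + (y + 1) = x + y + 1 + 1 := by ring
  rw [hn, hx, Nat.factorial_succ (x + y + 1 + 2 * (c + d)), Nat.factorial_succ (x + y + 1)]
    at hvand'
  unfold partWeight
  rw [Nat.cast_add_choose]
  have h1 : (0 : ℝ) < (x + 1)! := by positivity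
  have h2 : (0 : ℝ) < (y + 1)! := by positivity
  have h3 : (0 : ℝ) < (c)! := by positivity
  have h4 : (0 : ℝ) < (d)! := by positivity
  have h5 : (0 : ℝ) < (c + d)! := by positivity
  have h6 : (0 : ℝ) < (x + 1 + 2 * c)! := by positivity
  have h7 : (0 : ℝ) < (y + 1 + 2 * d)! := by positivity
  have h8 : (0 : ℝ) < (x + y + 1)! := by positivity
  have h9 : (0 : ℝ) < (x + y + 1 + 2 * (c + d))! := by positivity
  push_cast at hvand'
  generalize ((x + 1)! : ℝ) = X at *
  generalize ((y + 1)! : ℝ) = Y at *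
  generalize ((c)! : ℝ) = C at *
  generalize ((d)! : ℝ) = D at *
  generalize ((c + d)! : ℝ) = E at *
  generalize ((x + 1 + 2 * c)! : ℝ) = P at *
  generalize ((y + 1 + 2 * d)! : ℝ) = Q at *
  generalize ((x + y + 1)! : ℝ) = Z at *
  generalize ((x + y + 1 + 2 * (c + d))! : ℝ) = N at *
  have hx0 : (0 : ℝ) ≤ x := by positivity
  have hy0 : (0 : ℝ) ≤ y := by positivity
  have hc0 : (0 : ℝ) ≤ c := by positivity
  have hd0 : (0 : ℝ) ≤ d := by positivity
  have hs : (0 : ℝ) < x + y + 1 + 1 := by linarith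
  calc P / (X * C) * (Q / (Y * D)) * (E / (C * D))
      = (x + y + 1 + 1) * Z / (X * Y) * (E / (C * D) * (E / (C * D))) *
          (P * Q / ((x + y + 1 + 1) * Z * E)) := by field_simp
    _ ≤ (x + y + 1 + 2 * (c + d) + 1) * N / (P * Q) * (P * Q / ((x + y + 1 + 1) * Z * E)) := by
        gcongr
    _ = (x + y + 1 + 2 * (c + d) + 1) / (x + y + 1 + 1) * (N / (Z * E)) := by field_simp
    _ ≤ (1 + c + d) * (N / (Z * E)) := by
        gcongr
        rw [div_le_iff₀ hs]
        nlinarith [mul_nonneg hx0 hc0, mul_nonneg hx0 hd0, mul_nonneg hy0 hc0, mul_nonneg hy0 hd0]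

theorem succ_mul_le_choose {c d : ℕ} (hc : 0 < c) (hcd : c ≤ d) :
    (1 + c) * (1 + c + d) * 2 ^ c ≤ (1 + 4 * c * (c + 1)) * (c + d).choose c := by
  obtain ⟨e, rfl⟩ := Nat.exists_eq_succ_of_ne_zero hc.ne'
  have hpow := two_pow_le_choose (show e ≤ d by omega)
  have hmul := Nat.add_one_mul_choose_eq (e + d) e
  rw [Nat.succ_eq_add_one, show e + 1 + d = e + d + 1 by ring, pow_succ]
  generalize (e + d + 1).choose (e + 1) = K at *
  generalize (e + d).choose e = J at *
  have h1 : (1 + (e + 1) + d) * 2 ^ e ≤ 2 * (K * (e + 1)) := by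
    rw [← hmul]
    calc (1 + (e + 1) + d) * 2 ^ e ≤ (2 * (e + d + 1)) * J :=
          Nat.mul_le_mul (by omega) hpow
      _ = _ := by ring
  have h2 := Nat.mul_le_mul_left (2 * (1 + (e + 1))) h1
  nlinarith

/-- A summable majorant for the cost of merging two parts, the smaller one carrying `m`. -/
noncomputable def mergeCost (m : ℕ) : ℝ := (1 + 4 * m * (m + 1)) / 2 ^ m

theorem mergeCost_nonneg (m : ℕ) : 0 ≤ mergeCost m := by
  unfold mergeCost
  positivity

theorem sum_mergeCost_le (n : ℕ) : ∑ m ∈ range (n + 1), mergeCost m ≤ 64 := by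
  suffices h : ∑ m ∈ range (n + 1), mergeCost m ≤ 64 - (4 * n ^ 2 + 20 * n + 33 : ℝ) / 2 ^ n by
    have : (0 : ℝ) ≤ (4 * n ^ 2 + 20 * n + 33 : ℝ) / 2 ^ n := by positivity
    linarith
  induction n with
  | zero => norm_num [mergeCost]
  | succ n ih =>
    rw [Finset.sum_range_succ]
    have hstep : mergeCost (n + 1) =
        (4 * n ^ 2 + 20 * n + 33 : ℝ) / 2 ^ n -
          (4 * (n + 1 : ℕ) ^ 2 + 20 * (n + 1 : ℕ) + 33 : ℝ) / 2 ^ (n + 1) := by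
      unfold mergeCost
      rw [pow_succ]
      push_cast
      field_simp
      ring
    linarith

theorem partWeight_mul_le_of_le (x y : ℕ) {c d : ℕ} (hcd : c ≤ d) :
    (1 + c) * (partWeight (x + 1) c * partWeight (y + 1) d) ≤
      mergeCost c * partWeight (x + y + 1) (c + d) := by
  rcases Nat.eq_zero_or_pos c with rfl | hc
  · simpa [mergeCost] using partWeight_monotone d (show y + 1 ≤ x + y + 1 by omega)
  · have hK : (0 : ℝ) < (c + d).choose c := by
      exact_mod_cast Nat.choose_pos (Nat.le_add_right c d)
    have hmerge := partWeight_mul_choose_le x y c d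
    have hcost : ((1 + c) * (1 + c + d) * 2 ^ c : ℝ) ≤
        (1 + 4 * c * (c + 1)) * (c + d).choose c := by
      exact_mod_cast succ_mul_le_choose hc hcd
    have hcost' : ((1 + c) * (1 + c + d) : ℝ) ≤ mergeCost c * (c + d).choose c := by
      rw [mergeCost, div_mul_eq_mul_div, le_div_iff₀ (by positivity)]
      exact hcost
    refine le_of_mul_le_mul_right ?_ hK
    calc (1 + c) * (partWeight (x + 1) c * partWeight (y + 1) d) * (c + d).choose c
        = (1 + c) * (partWeight (x + 1) c * partWeight (y + 1) d * (c + d).choose c) := by ring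
      _ ≤ (1 + c) * ((1 + c + d) * partWeight (x + y + 1) (c + d)) := by gcongr
      _ = (1 + c) * (1 + c + d) * partWeight (x + y + 1) (c + d) := by ring
      _ ≤ mergeCost c * (c + d).choose c * partWeight (x + y + 1) (c + d) :=
          mul_le_mul_of_nonneg_right hcost' (partWeight_pos _ _).le
      _ = _ := by ring

theorem partWeight_mul_le (x y c d : ℕ) :
    (1 + min c d : ℕ) * (partWeight (x + 1) c * partWeight (y + 1) d) ≤
      (mergeCost c + mergeCost d) * partWeight (x + y + 1) (c + d) := by
  have hpos := (partWeight_pos (x + y + 1) (c + d)).le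
  rw [add_mul]
  rcases le_total c d with h | h
  · rw [min_eq_left h]
    push_cast
    linarith [partWeight_mul_le_of_le x y h, mul_nonneg (mergeCost_nonneg d) hpos]
  · rw [min_eq_right h]
    have := partWeight_mul_le_of_le y x h
    rw [add_comm y x, add_comm d c] at this
    push_cast
    linarith [mul_nonneg (mergeCost_nonneg c) hpos]

theorem sum_partWeight_mul_le (x y b : ℕ) :
    ∑ p ∈ antidiagonal b,
        (1 + min p.1 p.2 : ℕ) * (partWeight (x + 1) p.1 * partWeight (y + 1) p.2) ≤
      128 * partWeight (x + y + 1) b := by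
  have hfst : ∑ p ∈ antidiagonal b, mergeCost p.1 ≤ 64 := by
    rw [Finset.Nat.sum_antidiagonal_eq_sum_range_succ_mk]
    exact sum_mergeCost_le b
  have hsnd : ∑ p ∈ antidiagonal b, mergeCost p.2 ≤ 64 := by
    rw [← Finset.Nat.sum_antidiagonal_swap]
    exact hfst
  calc _ ≤ ∑ p ∈ antidiagonal b, (mergeCost p.1 + mergeCost p.2) * partWeight (x + y + 1) b := by
        refine Finset.sum_le_sum fun p hp => ?_
        rw [← Finset.HasAntidiagonal.mem_antidiagonal.mp hp]
        exact partWeight_mul_le x y p.1 p.2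
    _ = (∑ p ∈ antidiagonal b, mergeCost p.1 + ∑ p ∈ antidiagonal b, mergeCost p.2) *
          partWeight (x + y + 1) b := by rw [← Finset.sum_mul, Finset.sum_add_distrib]
    _ ≤ 128 * partWeight (x + y + 1) b :=
        mul_le_mul_of_nonneg_right (by linarith) (partWeight_pos _ _).le

/-- The product over `i` of `1 + min (B i) (∑ j > i, B j)`. -/
def tailMinProd {k : ℕ} (B : Fin k → ℕ) : ℕ :=
  ∏ i, (1 + min (B i) (∑ j, if i < j then B j else 0))

theorem tailMinProd_cons {k : ℕ} (c : ℕ) (B : Fin k → ℕ) :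
    tailMinProd (Fin.cons c B : Fin (k + 1) → ℕ) = (1 + min c (∑ j, B j)) * tailMinProd B := by
  simp [tailMinProd, Fin.prod_univ_succ, Fin.sum_univ_succ]

theorem one_add_min_le_tailMinProd {k : ℕ} (B : Fin k → ℕ) {i j : Fin k} (hij : i ≠ j) :
    1 + min (B i) (B j) ≤ tailMinProd B := by
  wlog h : i < j generalizing i j
  · rw [min_comm]
    exact this hij.symm (lt_of_le_of_ne (not_lt.mp h) hij.symm)
  have hsum : B j ≤ ∑ l, if i < l then B l else 0 := by
    have := Finset.single_le_sum (f := fun l => if i < l then B l else 0)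
      (fun _ _ => Nat.zero_le _) (Finset.mem_univ j)
    simpa [h] using this
  calc 1 + min (B i) (B j) ≤ 1 + min (B i) (∑ l, if i < l then B l else 0) := by
        gcongr
    _ ≤ tailMinProd B :=
        Finset.single_le_prod' (f := fun i => 1 + min (B i) (∑ l, if i < l then B l else 0))
          (fun _ _ => Nat.le_add_right _ _) (Finset.mem_univ i)

theorem sum_tailMinProd_mul_prod_le (k b : ℕ) (x : Fin (k + 1) → ℕ) :
    ∑ B ∈ weakCompositions b (k + 1), (tailMinProd B : ℝ) * ∏ i, partWeight (x i + 1) (B i) ≤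
      128 ^ k * partWeight (∑ i, x i + 1) b := by
  unfold weakCompositions
  induction k generalizing b with
  | zero => simp [tailMinProd]
  | succ k ih =>
    rw [sum_antidiagonalTuple_succ]
    calc _ ≤ ∑ p ∈ antidiagonal b, (1 + min p.1 p.2 : ℕ) * partWeight (x 0 + 1) p.1 *
            (128 ^ k * partWeight (∑ i, Fin.tail x i + 1) p.2) := by
          refine Finset.sum_le_sum fun p _ => ?_
          refine le_trans (le_of_eq ?_) (mul_le_mul_of_nonneg_left (ih p.2 (Fin.tail x))
            (mul_nonneg (Nat.cast_nonneg _) (partWeight_pos _ _).le))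
          rw [Finset.mul_sum]
          refine Finset.sum_congr rfl fun B hB => ?_
          rw [tailMinProd_cons, Finset.Nat.mem_antidiagonalTuple.mp hB, Fin.prod_univ_succ]
          simp only [Fin.cons_zero, Fin.cons_succ, Fin.tail]
          push_cast
          ring
      _ = 128 ^ k * ∑ p ∈ antidiagonal b, (1 + min p.1 p.2 : ℕ) *
            (partWeight (x 0 + 1) p.1 * partWeight (∑ i, Fin.tail x i + 1) p.2) := by
          rw [Finset.mul_sum]
          exact Finset.sum_congr rfl fun p _ => by ring
      _ ≤ 128 ^ k * (128 * partWeight (x 0 + ∑ i, Fin.tail x i + 1) b) := by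
          gcongr
          exact sum_partWeight_mul_le _ _ _
      _ = _ := by
          rw [Fin.sum_univ_succ x, pow_succ, mul_assoc]
          rfl

theorem second_max_le_tailMinProd {k n : ℕ} (hk : 0 < k) {A : Fin (k + 1) → ℕ}
    (hA : ∑ i, A i = n) (B : Fin (k + 1) → ℕ) :
    A (hIdx A B) + 2 * B (hIdx A B) + 1 ≤ 2 ^ (n + 1) * tailMinProd B := by
  have hs := minIdxOfMaxOn_spec (fun i => A i + 2 * B i)
    (Finset.univ_nonempty (α := Fin (k + 1)))
  have hne : (Finset.univ.erase (sIdx A B)).Nonempty := by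
    rw [← Finset.card_pos, Finset.card_erase_of_mem (Finset.mem_univ _)]
    simpa using hk
  have hmem := (minIdxOfMaxOn_spec (fun i => A i + 2 * B i) hne).1
  have hle : A (hIdx A B) + 2 * B (hIdx A B) ≤ A (sIdx A B) + 2 * B (sIdx A B) :=
    hs.2 _ (Finset.mem_univ _)
  have hM := one_add_min_le_tailMinProd B (Finset.ne_of_mem_erase hmem)
  change 1 + min (B (hIdx A B)) (B (sIdx A B)) ≤ _ at hM
  have hAle : ∀ i, A i ≤ n := fun i =>
    hA ▸ Finset.single_le_sum (fun _ _ => Nat.zero_le _) (Finset.mem_univ i)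
  have hAh := hAle (hIdx A B)
  have hAs := hAle (sIdx A B)
  have hn : n + 1 ≤ 2 ^ n := Nat.lt_two_pow_self
  calc A (hIdx A B) + 2 * B (hIdx A B) + 1
      ≤ n + 2 * min (B (hIdx A B)) (B (sIdx A B)) + 1 := by omega
    _ ≤ 2 * (n + 1) * (1 + min (B (hIdx A B)) (B (sIdx A B))) := by
        nlinarith [Nat.zero_le (n * min (B (hIdx A B)) (B (sIdx A B)))]
    _ ≤ 2 * 2 ^ n * tailMinProd B := by gcongr
    _ = 2 ^ (n + 1) * tailMinProd B := by ring

theorem sum_second_max_prod_le {a k n b : ℕ} (hk : 0 < k) (hn : n = a + k) {A : Fin (k + 1) → ℕ}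
    (hA : A ∈ compositions n (k + 1)) :
    ∑ B ∈ weakCompositions b (k + 1), ((A (hIdx A B) + 2 * B (hIdx A B) + 1 : ℕ) : ℝ) *
        ∏ i, partWeight (A i) (B i) ≤ 2 ^ (n + 1) * 128 ^ k * partWeight a b := by
  obtain ⟨hmem, hpos⟩ := Finset.mem_filter.mp hA
  rw [Finset.Nat.mem_antidiagonalTuple] at hmem
  have hpred : ∀ i, A i - 1 + 1 = A i := fun i => Nat.sub_add_cancel (hpos i)
  have hsum : ∑ i, (A i - 1) + 1 = a := by
    have : ∑ i, (A i - 1 + 1) = n := by simpa only [hpred] using hmem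
    simp [Finset.sum_add_distrib] at this
    omega
  have hmain := sum_tailMinProd_mul_prod_le k b fun i => A i - 1
  simp only [hpred, hsum] at hmain
  calc _ ≤ ∑ B ∈ weakCompositions b (k + 1),
          2 ^ (n + 1) * ((tailMinProd B : ℝ) * ∏ i, partWeight (A i) (B i)) := by
        refine Finset.sum_le_sum fun B _ => ?_
        rw [← mul_assoc]
        refine mul_le_mul_of_nonneg_right ?_ (Finset.prod_nonneg fun i _ => (partWeight_pos _ _).le)
        exact_mod_cast second_max_le_tailMinProd hk hmem B
    _ ≤ 2 ^ (n + 1) * (128 ^ k * partWeight a b) := by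
        rw [← Finset.mul_sum]
        gcongr
    _ = _ := by ring

/-- Let `L > a ≥ 0` and `b ≥ 0` be integers.  Then, with `𝔥 = 𝔥(A,B)`
the minimal index realizing the second largest value of `A_i + 2B_i`,
`Σ_{A ∈ C_L(L−a+1)} Σ_{B ∈ G_b(L−a+1)} (A_𝔥 + 2B_𝔥 + 1) ∏_i (A_i + 2B_i)!/(A_i!·B_i!)
  ≤ 2^{9L+5}·(a+2b)!/(a!·b!)`. -/
theorem sum_compositions_second_max_prod_le (L a b : ℕ) (haL : a < L) :
    ∑ A ∈ compositions L (L - a + 1), ∑ B ∈ weakCompositions b (L - a + 1),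
      ((A (hIdx A B) + 2 * B (hIdx A B) + 1 : ℕ) : ℝ) *
        ∏ i, ((A i + 2 * B i)! : ℝ) / ((A i)! * (B i)!) ≤
    2 ^ (9 * L + 5) * (a + 2 * b)! / ((a)! * (b)!) := by
  calc _ ≤ ∑ _A ∈ compositions L (L - a + 1),
          (2 : ℝ) ^ (L + 1) * 128 ^ (L - a) * partWeight a b :=
        Finset.sum_le_sum fun A hA => sum_second_max_prod_le (by omega) (by omega) hA
    _ = #(compositions L (L - a + 1)) * (2 ^ (L + 1) * 128 ^ (L - a) * partWeight a b) := by
        rw [Finset.sum_const, nsmul_eq_mul]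
    _ ≤ 2 ^ L * (2 ^ (L + 1) * 128 ^ (L - a) * partWeight a b) := by
        have := (partWeight_pos a b).le
        gcongr
        exact_mod_cast card_compositions_le _ _
    _ = 2 ^ (L + (L + 1) + 7 * (L - a)) * partWeight a b := by
        rw [pow_add, pow_add, pow_mul]
        norm_num
        ring
    _ ≤ 2 ^ (9 * L + 5) * partWeight a b := by
        have := (partWeight_pos a b).le
        exact mul_le_mul_of_nonneg_right (pow_le_pow_right₀ one_le_two (by omega)) this
    _ = _ := by
        rw [partWeight, mul_div_assoc]
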